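/- arXiv:1503.01328 — 2 statements merged into one kernel-verified Lean document; each statement's English description precedes it below -/
import Mathlib

section
/- For all real constants a > 0 and b ∈ ℝ, (1/(√2 π)) ∫_{λ₁≤λ₂≤λ₃} e^{-λ₁²/2} e^{-λ₂²/2} e^{-a(λ₃-b)²} (λ₂-λ₁)(λ₃-λ₁)(λ₃-λ₂) dλ₁ dλ₂ dλ₃ = (1/a + 2b² - 1)(1/√(2a)) Φ( b√(2a)/√(a+1) ) + (b√(a+1)/(√(2π) a)) e^{-a b²/(a+1)} + (√2/√(2a+1)) e^{-a b²/(2a+1)} Φ( √2 a b/√((2a+1)(a+1)) ). -/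
open MeasureTheory Real

/-- Standard normal cumulative distribution function. -/
noncomputable def Phi (x : ℝ) : ℝ :=
  ∫ t in Set.Iic x, (Real.sqrt (2 * Real.pi))⁻¹ * Real.exp (-(t ^ 2) / 2)

/-- The unnormalized Gaussian integral `∫_{-∞}^x exp (-k s²) ds`. -/
noncomputable def gaussianTail (k x : ℝ) : ℝ :=
  ∫ s in Set.Iic x, Real.exp (-k * s ^ 2)

theorem gaussianTail_eq_setIntegral_Ioi (k x : ℝ) :
    gaussianTail k x = ∫ v in Set.Ioi 0, Real.exp (-k * (v - x) ^ 2) := by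
  have h1 : gaussianTail k x = ∫ s in Set.Ioi (-x), Real.exp (-k * s ^ 2) := by
    rw [← integral_comp_neg_Iic]
    simp [gaussianTail]
  have h2 := (measurePreserving_sub_right volume x).setIntegral_preimage_emb
    (measurableEmbedding_subRight x) (fun s => Real.exp (-k * s ^ 2)) (Set.Ioi (-x))
  rw [h1, ← h2]
  simp

theorem gaussianTail_eq_Phi {k : ℝ} (hk : 0 < k) (x : ℝ) :
    gaussianTail k x = √(π / k) * Phi (x * √(2 * k)) := by
  have hc : 0 < √(2 * k) := by positivity
  have h1 : gaussianTail k x = ∫ s in Set.Ioi (-x), Real.exp (-k * s ^ 2) := by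
    rw [← integral_comp_neg_Iic]
    simp [gaussianTail]
  have h2 : Phi (x * √(2 * k)) =
      (√(2 * π))⁻¹ * ∫ t in Set.Ioi (√(2 * k) * -x), Real.exp (-(t ^ 2) / 2) := by
    rw [Phi, integral_const_mul, mul_neg, ← integral_comp_neg_Iic, mul_comm x]
    simp
  have h3 := integral_comp_mul_left_Ioi (fun t => Real.exp (-(t ^ 2) / 2)) (-x) hc
  have h4 : ∀ s : ℝ, -((√(2 * k) * s) ^ 2) / 2 = -k * s ^ 2 := fun s => by
    rw [mul_pow, Real.sq_sqrt (by positivity)]; ring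
  simp only [h4, smul_eq_mul] at h3
  rw [h1, h3, h2, Real.sqrt_mul (by norm_num) k, Real.sqrt_mul (by norm_num) π,
    Real.sqrt_div (by positivity)]
  field_simp

theorem exp_mul_exp_eq_of_add_ne_zero {α c : ℝ} (h : α + c ≠ 0) (β γ x : ℝ) :
    Real.exp (-α * (x - β) ^ 2) * Real.exp (-c * (x - γ) ^ 2) =
      Real.exp (-(α * c / (α + c)) * (γ - β) ^ 2) *
        Real.exp (-(α + c) * (x - (α * β + c * γ) / (α + c)) ^ 2) := by
  rw [← Real.exp_add, ← Real.exp_add]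
  congr 1
  field_simp
  ring

theorem integral_exp_neg_mul_sub_sq (k β : ℝ) :
    ∫ x : ℝ, Real.exp (-k * (x - β) ^ 2) = √(π / k) := by
  rw [integral_sub_right_eq_self (fun x => Real.exp (-k * x ^ 2)), integral_gaussian]

theorem integral_exp_mul_exp {α c : ℝ} (h : α + c ≠ 0) (β γ : ℝ) :
    ∫ x : ℝ, Real.exp (-α * (x - β) ^ 2) * Real.exp (-c * (x - γ) ^ 2) =
      Real.exp (-(α * c / (α + c)) * (γ - β) ^ 2) * √(π / (α + c)) := by
  simp_rw [exp_mul_exp_eq_of_add_ne_zero h]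
  rw [integral_const_mul, integral_exp_neg_mul_sub_sq]

theorem integral_exp_mul_gaussianTail {α c : ℝ} (hα : 0 < α) (hc : 0 < c) (β : ℝ) :
    ∫ x : ℝ, Real.exp (-α * (x - β) ^ 2) * gaussianTail c x =
      √(π / (α + c)) * gaussianTail (α * c / (α + c)) β := by
  have hint : Integrable (Function.uncurry fun v x : ℝ =>
      Real.exp (-α * (x - β) ^ 2) * Real.exp (-c * (v - x) ^ 2))
      ((volume.restrict (Set.Ioi 0)).prod volume) := by
    have h := Integrable.convolution_integrand (ContinuousLinearMap.mul ℝ ℝ)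
      ((integrable_exp_neg_mul_sq hα).comp_sub_right β) (integrable_exp_neg_mul_sq hc)
    refine Integrable.mono_measure h ?_
    exact Measure.prod_mono Measure.restrict_le_self le_rfl
  simp_rw [gaussianTail_eq_setIntegral_Ioi, ← integral_const_mul]
  rw [← integral_integral_swap hint]
  refine integral_congr_ae (ae_of_all _ fun v => ?_)
  simp only
  simp_rw [← neg_sub _ v, neg_sq]
  rw [integral_exp_mul_exp (by positivity), mul_comm, ← neg_sub v, neg_sq]

theorem hasDerivAt_gaussianTail {k : ℝ} (hk : 0 < k) (x : ℝ) :
    HasDerivAt (gaussianTail k) (Real.exp (-k * x ^ 2)) x := by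
  have hi := integrable_exp_neg_mul_sq hk
  have hc : Continuous fun s : ℝ => Real.exp (-k * s ^ 2) := by fun_prop
  have h : gaussianTail k = fun x => gaussianTail k 0 + ∫ s in (0 : ℝ)..x, Real.exp (-k * s ^ 2) := by
    funext x
    rw [← intervalIntegral.integral_Iic_sub_Iic hi.integrableOn hi.integrableOn]
    simp [gaussianTail]
  rw [h]
  exact (intervalIntegral.integral_hasDerivAt_right (hc.intervalIntegrable _ _)
    (hc.stronglyMeasurableAtFilter _ _) hc.continuousAt).const_add _

theorem continuous_gaussianTail {k : ℝ} (hk : 0 < k) : Continuous (gaussianTail k) :=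
  continuous_iff_continuousAt.2 fun x => (hasDerivAt_gaussianTail hk x).continuousAt

theorem norm_gaussianTail_le {k : ℝ} (hk : 0 < k) (x : ℝ) : ‖gaussianTail k x‖ ≤ √(π / k) := by
  rw [← integral_gaussian, gaussianTail,
    Real.norm_of_nonneg (integral_nonneg fun _ => (Real.exp_pos _).le)]
  exact setIntegral_le_integral (integrable_exp_neg_mul_sq hk)
    (ae_of_all _ fun _ => (Real.exp_pos _).le)

theorem integrable_quadratic_mul_exp {k : ℝ} (hk : 0 < k) (A B C β : ℝ) :
    Integrable fun x : ℝ => (A * x ^ 2 + B * x + C) * Real.exp (-k * (x - β) ^ 2) := by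
  have h2 := integrable_rpow_mul_exp_neg_mul_sq hk (s := (2 : ℕ)) (by norm_num)
  simp_rw [Real.rpow_natCast] at h2
  have h := ((h2.const_mul A).add
    (((integrable_mul_exp_neg_mul_sq hk).const_mul (2 * A * β + B)).add
      ((integrable_exp_neg_mul_sq hk).const_mul (A * β ^ 2 + B * β + C)))).comp_sub_right β
  refine h.congr (ae_of_all _ fun x => ?_)
  simp only [Pi.add_apply]
  ring

theorem integrable_quadratic_mul_exp_mul_gaussianTail {k c : ℝ} (hk : 0 < k) (hc : 0 < c)
    (A B C β : ℝ) :
    Integrable fun x : ℝ =>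
      (A * x ^ 2 + B * x + C) * Real.exp (-k * (x - β) ^ 2) * gaussianTail c x :=
  (integrable_quadratic_mul_exp hk A B C β).mul_bdd
    (continuous_gaussianTail hc).aestronglyMeasurable (ae_of_all _ (norm_gaussianTail_le hc))

theorem setIntegral_Iic_eq_of_hasDerivAt_of_integrable {f f' : ℝ → ℝ}
    (hd : ∀ x, HasDerivAt f (f' x) x) (hf' : Integrable f') (hf : Integrable f) (y : ℝ) :
    ∫ x in Set.Iic y, f' x = f y := by
  rw [integral_Iic_of_hasDerivAt_of_tendsto' (fun x _ => hd x) hf'.integrableOn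
    (tendsto_zero_of_hasDerivAt_of_integrableOn_Iic (fun x _ => hd x) hf'.integrableOn
      (hf.integrableOn (s := Set.Iic y))), sub_zero]

theorem hasDerivAt_exp_neg_mul_sub_sq (k β x : ℝ) :
    HasDerivAt (fun x : ℝ => Real.exp (-k * (x - β) ^ 2))
      (-2 * k * (x - β) * Real.exp (-k * (x - β) ^ 2)) x := by
  have h : HasDerivAt (fun x : ℝ => -k * (x - β) ^ 2) (-2 * k * (x - β)) x :=
    ((((hasDerivAt_id' x).sub_const β).pow 2).const_mul (-k)).congr_deriv (by simp; ring)
  exact h.exp.congr_deriv (by ring)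

theorem hasDerivAt_exp_neg_mul_sq (k x : ℝ) :
    HasDerivAt (fun x : ℝ => Real.exp (-k * x ^ 2)) (-2 * k * x * Real.exp (-k * x ^ 2)) x := by
  simpa using hasDerivAt_exp_neg_mul_sub_sq k 0 x

theorem exp_neg_half_mul_sq_sq (x : ℝ) :
    Real.exp (-(1 / 2) * x ^ 2) ^ 2 = Real.exp (-1 * x ^ 2) := by
  rw [← Real.exp_nat_mul]
  congr 1
  push_cast
  ring

theorem setIntegral_Iic_exp_mul_sub_mul_sub (x y : ℝ) :
    ∫ l in Set.Iic y, Real.exp (-(1 / 2) * l ^ 2) * ((y - l) * (x - l)) =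
      (x * y + 1) * gaussianTail (1 / 2) y + x * Real.exp (-(1 / 2) * y ^ 2) := by
  have hk : (0 : ℝ) < 1 / 2 := by norm_num
  have hd : ∀ l, HasDerivAt (fun l : ℝ => (x + y - l) * Real.exp (-(1 / 2) * l ^ 2))
      ((l ^ 2 - (x + y) * l - 1) * Real.exp (-(1 / 2) * l ^ 2)) l := fun l =>
    (((hasDerivAt_id' l).const_sub (x + y)).mul
      (hasDerivAt_exp_neg_mul_sq (1 / 2) l)).congr_deriv (by ring)
  have hi' : Integrable fun l : ℝ => (l ^ 2 - (x + y) * l - 1) * Real.exp (-(1 / 2) * l ^ 2) :=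
    (integrable_quadratic_mul_exp hk 1 (-(x + y)) (-1) 0).congr
      (ae_of_all _ fun l => by simp only [sub_zero]; ring)
  have hi : Integrable fun l : ℝ => (x + y - l) * Real.exp (-(1 / 2) * l ^ 2) :=
    (integrable_quadratic_mul_exp hk 0 (-1) (x + y) 0).congr
      (ae_of_all _ fun l => by simp only [sub_zero]; ring)
  have hsplit : ∀ l : ℝ, Real.exp (-(1 / 2) * l ^ 2) * ((y - l) * (x - l)) =
      (x * y + 1) * Real.exp (-(1 / 2) * l ^ 2) +
        (l ^ 2 - (x + y) * l - 1) * Real.exp (-(1 / 2) * l ^ 2) := fun l => by ring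
  simp_rw [hsplit]
  rw [integral_add ((integrable_exp_neg_mul_sq hk).const_mul _).integrableOn hi'.integrableOn,
    integral_const_mul, setIntegral_Iic_eq_of_hasDerivAt_of_integrable hd hi' hi, gaussianTail]
  ring

theorem setIntegral_Iic_exp_mul_sub_mul_gaussianTail (x : ℝ) :
    ∫ y in Set.Iic x, Real.exp (-(1 / 2) * y ^ 2) * (x - y) *
        ((x * y + 1) * gaussianTail (1 / 2) y + x * Real.exp (-(1 / 2) * y ^ 2)) =
      (2 * x ^ 2 - 1) * gaussianTail 1 x +
        Real.exp (-(1 / 2) * x ^ 2) * gaussianTail (1 / 2) x + x * Real.exp (-1 * x ^ 2) := by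
  have hk : (0 : ℝ) < 1 / 2 := by norm_num
  set f : ℝ → ℝ := fun y =>
    (1 - x ^ 2 + x * y) * Real.exp (-(1 / 2) * y ^ 2) * gaussianTail (1 / 2) y +
      x * Real.exp (-1 * y ^ 2) with hf
  set f' : ℝ → ℝ := fun y =>
    (x - y) * (x * y + 1) * Real.exp (-(1 / 2) * y ^ 2) * gaussianTail (1 / 2) y +
      (1 - x ^ 2 - x * y) * Real.exp (-1 * y ^ 2) with hf'
  have hd : ∀ y, HasDerivAt f (f' y) y := fun y =>
    ((((((hasDerivAt_id' y).const_mul x).const_add (1 - x ^ 2)).mul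
      (hasDerivAt_exp_neg_mul_sq (1 / 2) y)).mul (hasDerivAt_gaussianTail hk y)).add
        ((hasDerivAt_exp_neg_mul_sq 1 y).const_mul x)).congr_deriv (by
      simp only [hf', ← exp_neg_half_mul_sq_sq, Pi.mul_apply]
      ring)
  have hi' : Integrable f' :=
    ((integrable_quadratic_mul_exp_mul_gaussianTail hk hk (-x) (x ^ 2 - 1) x 0).add
      (integrable_quadratic_mul_exp one_pos 0 (-x) (1 - x ^ 2) 0)).congr
      (ae_of_all _ fun y => by simp only [hf', Pi.add_apply, sub_zero]; ring)
  have hi : Integrable f :=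
    ((integrable_quadratic_mul_exp_mul_gaussianTail hk hk 0 x (1 - x ^ 2) 0).add
      (integrable_quadratic_mul_exp one_pos 0 0 x 0)).congr
      (ae_of_all _ fun y => by simp only [hf, Pi.add_apply, sub_zero]; ring)
  have hsplit : ∀ y : ℝ, Real.exp (-(1 / 2) * y ^ 2) * (x - y) *
      ((x * y + 1) * gaussianTail (1 / 2) y + x * Real.exp (-(1 / 2) * y ^ 2)) =
      (2 * x ^ 2 - 1) * Real.exp (-1 * y ^ 2) + f' y := fun y => by
    simp only [hf', ← exp_neg_half_mul_sq_sq]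
    ring
  simp_rw [hsplit]
  rw [integral_add ((integrable_exp_neg_mul_sq one_pos).const_mul _).integrableOn
    hi'.integrableOn, integral_const_mul,
    setIntegral_Iic_eq_of_hasDerivAt_of_integrable hd hi' hi, gaussianTail]
  simp only [hf]
  ring

theorem integral_iterated_eq_integral (a b : ℝ) :
    (∫ l3 : ℝ, ∫ l2 in Set.Iic l3, ∫ l1 in Set.Iic l2,
      Real.exp (-(l1 ^ 2) / 2) * Real.exp (-(l2 ^ 2) / 2) *
        Real.exp (-a * (l3 - b) ^ 2) * ((l2 - l1) * (l3 - l1) * (l3 - l2))) =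
      ∫ x : ℝ, Real.exp (-a * (x - b) ^ 2) * ((2 * x ^ 2 - 1) * gaussianTail 1 x +
        Real.exp (-(1 / 2) * x ^ 2) * gaussianTail (1 / 2) x + x * Real.exp (-1 * x ^ 2)) := by
  have hhalf : ∀ l : ℝ, -(l ^ 2) / 2 = -(1 / 2) * l ^ 2 := fun l => by ring
  refine integral_congr_ae (ae_of_all _ fun x => ?_)
  simp only
  rw [← setIntegral_Iic_exp_mul_sub_mul_gaussianTail, ← integral_const_mul]
  refine integral_congr_ae (ae_of_all _ fun y => ?_)
  simp only
  rw [← setIntegral_Iic_exp_mul_sub_mul_sub, ← integral_const_mul, ← integral_const_mul]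
  refine integral_congr_ae (ae_of_all _ fun l => ?_)
  simp only [hhalf]
  ring

theorem integral_exp_mul_quadratic_mul_gaussianTail {a : ℝ} (ha : 0 < a) (b : ℝ) :
    ∫ x : ℝ, Real.exp (-a * (x - b) ^ 2) * ((2 * x ^ 2 - 1) * gaussianTail 1 x +
        Real.exp (-(1 / 2) * x ^ 2) * gaussianTail (1 / 2) x + x * Real.exp (-1 * x ^ 2)) =
      (1 / a + 2 * b ^ 2 - 1) * (√(π / (a + 1)) * gaussianTail (a / (a + 1)) b) +
      b * (a + 1) / a * (Real.exp (-a * b ^ 2 / (a + 1)) * √(π / (a + 1))) +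
      Real.exp (-a * b ^ 2 / (2 * a + 1)) * (√(π / (a + 1)) *
        gaussianTail ((2 * a + 1) / (4 * (a + 1))) (2 * a * b / (2 * a + 1))) := by
  have hk : (0 : ℝ) < 1 / 2 := by norm_num
  set w : ℝ → ℝ := fun x => Real.exp (-a * (x - b) ^ 2) with hw
  set m := (a * b + 1 * 0) / (a + 1) with hm
  set C := Real.exp (-(a * 1 / (a + 1)) * (0 - b) ^ 2) with hC
  set m' := (a * b + 1 / 2 * 0) / (a + 1 / 2) with hm'
  set C' := Real.exp (-(a * (1 / 2) / (a + 1 / 2)) * (0 - b) ^ 2) with hC'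
  have hwe : ∀ x, w x * Real.exp (-1 * x ^ 2) = C * Real.exp (-(a + 1) * (x - m) ^ 2) := fun x => by
    have h := exp_mul_exp_eq_of_add_ne_zero (α := a) (c := 1) (by positivity) b 0 x
    rw [sub_zero] at h
    exact h
  have hwp : ∀ x, w x * Real.exp (-(1 / 2) * x ^ 2) =
      C' * Real.exp (-(a + 1 / 2) * (x - m') ^ 2) := fun x => by
    have h := exp_mul_exp_eq_of_add_ne_zero (α := a) (c := 1 / 2) (by positivity) b 0 x
    rw [sub_zero] at h
    exact h
  set f : ℝ → ℝ := fun x =>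
    -(1 / a) * ((x + b) * w x * gaussianTail 1 x) -
      1 / (2 * a) * (w x * Real.exp (-1 * x ^ 2)) with hf
  set f' : ℝ → ℝ := fun x =>
    (2 * x ^ 2 - 2 * b ^ 2 - 1 / a) * w x * gaussianTail 1 x +
      (x - b * (a + 1) / a) * (w x * Real.exp (-1 * x ^ 2)) with hf'
  have hdw : ∀ x, HasDerivAt w (-2 * a * (x - b) * w x) x := hasDerivAt_exp_neg_mul_sub_sq a b
  have hd : ∀ x, HasDerivAt f (f' x) x := fun x =>
    ((((((hasDerivAt_id' x).add_const b).mul (hdw x)).mul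
      (hasDerivAt_gaussianTail one_pos x)).const_mul (-(1 / a))).sub
        (((hdw x).mul (hasDerivAt_exp_neg_mul_sq 1 x)).const_mul (1 / (2 * a)))).congr_deriv (by
      simp only [hf', Pi.mul_apply]
      field_simp
      ring)
  have hi' : Integrable f' :=
    ((integrable_quadratic_mul_exp_mul_gaussianTail ha one_pos 2 0 (-2 * b ^ 2 - 1 / a) b).add
      ((integrable_quadratic_mul_exp (k := a + 1) (by positivity) 0 1
        (-(b * (a + 1) / a)) m).const_mul C)).congr
      (ae_of_all _ fun x => by simp only [hf', hwe, Pi.add_apply]; ring)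
  have hi : Integrable f :=
    (((integrable_quadratic_mul_exp_mul_gaussianTail ha one_pos 0 1 b b).const_mul (-(1 / a))).sub
      ((integrable_quadratic_mul_exp (k := a + 1) (by positivity) 0 0 1 m).const_mul
        (1 / (2 * a) * C))).congr
      (ae_of_all _ fun x => by simp only [hf, hwe, Pi.sub_apply]; ring)
  have hi1 : Integrable fun x => (1 / a + 2 * b ^ 2 - 1) * (w x * gaussianTail 1 x) :=
    ((integrable_quadratic_mul_exp_mul_gaussianTail ha one_pos 0 0 1 b).const_mul
      (1 / a + 2 * b ^ 2 - 1)).congr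
      (ae_of_all _ fun x => by simp only [hw]; ring)
  have hi2 : Integrable fun x => b * (a + 1) / a * (w x * Real.exp (-1 * x ^ 2)) :=
    ((integrable_quadratic_mul_exp (k := a + 1) (by positivity) 0 0 1 m).const_mul
      (b * (a + 1) / a * C)).congr (ae_of_all _ fun x => by simp only [hwe]; ring)
  have hi3 : Integrable fun x =>
      C' * (Real.exp (-(a + 1 / 2) * (x - m') ^ 2) * gaussianTail (1 / 2) x) :=
    ((integrable_quadratic_mul_exp_mul_gaussianTail (k := a + 1 / 2) (by positivity) hk
      0 0 1 m').const_mul C').congr (ae_of_all _ fun x => by ring)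
  have hsplit : ∀ x : ℝ, w x * ((2 * x ^ 2 - 1) * gaussianTail 1 x +
        Real.exp (-(1 / 2) * x ^ 2) * gaussianTail (1 / 2) x + x * Real.exp (-1 * x ^ 2)) =
      (1 / a + 2 * b ^ 2 - 1) * (w x * gaussianTail 1 x) +
      b * (a + 1) / a * (w x * Real.exp (-1 * x ^ 2)) +
      C' * (Real.exp (-(a + 1 / 2) * (x - m') ^ 2) * gaussianTail (1 / 2) x) + f' x := fun x => by
    rw [← mul_assoc C', ← hwp]
    simp only [hf']
    ring
  have e1 : ∫ x, w x * gaussianTail 1 x = √(π / (a + 1)) * gaussianTail (a / (a + 1)) b := by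
    have h := integral_exp_mul_gaussianTail ha one_pos b
    rw [mul_one] at h
    exact h
  have e2 : ∫ x, w x * Real.exp (-1 * x ^ 2) = C * √(π / (a + 1)) := by
    simp_rw [hwe]
    rw [integral_const_mul, integral_exp_neg_mul_sub_sq]
  have hC_eq : C = Real.exp (-a * b ^ 2 / (a + 1)) := by
    rw [hC]; congr 1; ring
  have hC'_eq : C' = Real.exp (-a * b ^ 2 / (2 * a + 1)) := by
    rw [hC']; congr 1; field_simp; ring
  have hm'_eq : m' = 2 * a * b / (2 * a + 1) := by
    rw [hm']; field_simp; ring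
  have hk' : (a + 1 / 2) * (1 / 2) / (a + 1) = (2 * a + 1) / (4 * (a + 1)) := by
    field_simp; ring
  have hsum : a + 1 / 2 + 1 / 2 = a + 1 := by ring
  refine (integral_congr_ae (ae_of_all _ hsplit)).trans ?_
  refine (integral_add ((hi1.add hi2).add hi3) hi').trans ?_
  rw [integral_add' (hi1.add hi2) hi3, integral_add' hi1 hi2, integral_const_mul, integral_const_mul, integral_const_mul, e1, e2,
    integral_exp_mul_gaussianTail (by positivity) hk,
    integral_eq_zero_of_hasDerivAt_of_integrable hd hi' hi, hsum, hk', hC_eq, hC'_eq, hm'_eq]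
  ring

theorem stmt4 (a b : ℝ) (ha : 0 < a) :
    (1 / (Real.sqrt 2 * Real.pi)) *
        ∫ l3 : ℝ, ∫ l2 in Set.Iic l3, ∫ l1 in Set.Iic l2,
          Real.exp (-(l1 ^ 2) / 2) * Real.exp (-(l2 ^ 2) / 2) *
            Real.exp (-a * (l3 - b) ^ 2) * ((l2 - l1) * (l3 - l1) * (l3 - l2)) =
      (1 / a + 2 * b ^ 2 - 1) * (1 / Real.sqrt (2 * a)) *
          Phi (b * Real.sqrt (2 * a) / Real.sqrt (a + 1)) +
        b * Real.sqrt (a + 1) / (Real.sqrt (2 * Real.pi) * a) *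
          Real.exp (-a * b ^ 2 / (a + 1)) +
        Real.sqrt 2 / Real.sqrt (2 * a + 1) * Real.exp (-a * b ^ 2 / (2 * a + 1)) *
          Phi (Real.sqrt 2 * a * b / Real.sqrt ((2 * a + 1) * (a + 1))) := by
  have hk : 0 < a / (a + 1) := by positivity
  have hk' : 0 < (2 * a + 1) / (4 * (a + 1)) := by positivity
  have h1 : b * √(2 * (a / (a + 1))) = b * √(2 * a) / √(a + 1) := by
    rw [← mul_div_assoc 2 a, Real.sqrt_div (by positivity), mul_div_assoc]
  have h2 : 2 * a * b / (2 * a + 1) * √(2 * ((2 * a + 1) / (4 * (a + 1)))) =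
      √2 * a * b / √((2 * a + 1) * (a + 1)) := by
    have h : 2 * ((2 * a + 1) / (4 * (a + 1))) = (2 * a + 1) / (2 * (a + 1)) := by
      field_simp
      ring
    have hs := Real.sq_sqrt (show 0 ≤ 2 * a + 1 by positivity)
    have hs2 := Real.sq_sqrt (show (0 : ℝ) ≤ 2 by norm_num)
    rw [h, Real.sqrt_div (by positivity), Real.sqrt_mul (by norm_num),
      Real.sqrt_mul (by positivity)]
    field_simp
    rw [hs, hs2]
    ring
  have h3 : √(π / (a + 1)) * √(π / (a / (a + 1))) = √2 * π * (1 / √(2 * a)) := by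
    rw [← Real.sqrt_mul (by positivity), Real.sqrt_mul (by norm_num) a]
    have h : π / (a + 1) * (π / (a / (a + 1))) = π ^ 2 / a := by field_simp
    rw [h, Real.sqrt_div (by positivity), Real.sqrt_sq (by positivity)]
    field_simp
  have h4 : √(π / (a + 1)) * √(π / ((2 * a + 1) / (4 * (a + 1)))) =
      √2 * π * (√2 / √(2 * a + 1)) := by
    have hs2 := Real.sq_sqrt (show (0 : ℝ) ≤ 2 by norm_num)
    rw [← Real.sqrt_mul (by positivity)]
    have h : π / (a + 1) * (π / ((2 * a + 1) / (4 * (a + 1)))) = (2 * π) ^ 2 / (2 * a + 1) := by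
      field_simp
      ring
    rw [h, Real.sqrt_div (by positivity), Real.sqrt_sq (by positivity)]
    field_simp
    rw [hs2]
  have h5 : b * (a + 1) / a * √(π / (a + 1)) =
      √2 * π * (b * √(a + 1) / (√(2 * π) * a)) := by
    have hs := Real.sq_sqrt (show 0 ≤ a + 1 by positivity)
    have hs2 := Real.sq_sqrt Real.pi_pos.le
    rw [Real.sqrt_div (by positivity), Real.sqrt_mul (by norm_num)]
    field_simp
    rw [hs, hs2]
  have hc : √2 * π ≠ 0 := by positivity
  rw [integral_iterated_eq_integral, integral_exp_mul_quadratic_mul_gaussianTail ha,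
    gaussianTail_eq_Phi hk, gaussianTail_eq_Phi hk', h1, h2, one_div_mul_eq_div, div_eq_iff hc]
  linear_combination
    (1 / a + 2 * b ^ 2 - 1) * Phi (b * √(2 * a) / √(a + 1)) * h3 +
      Real.exp (-a * b ^ 2 / (a + 1)) * h5 +
      Real.exp (-a * b ^ 2 / (2 * a + 1)) *
        Phi (√2 * a * b / √((2 * a + 1) * (a + 1))) * h4
end

section
/- For all real constants a > 0 and b ∈ ℝ, (1/(2π)) ∫_{λ₁≤λ₂≤λ₃≤λ₄} e^{-λ₁²/2} e^{-λ₂²/2} e^{-λ₃²/2} e^{-a(λ₄-b)²} ∏_{1≤i<j≤4}(λ_j-λ_i) dλ₁ dλ₂ dλ₃ dλ₄ = [ ((24a³+12a²+6a+1)/(2a(2a+1)²)) b² + (6a²+3a+2)/(4a²(2a+1)) + 3/2 ] · (1/√(2(2a+1))) e^{-a b²/(2a+1)} Φ( 2√2 a b/√((2a+1)(2a+3)) ) + [ ((a+1)/(2a)) b² + (1-a)/(2a²) - 1 ] · (1/√(2(a+1))) e^{-a b²/(a+1)} Φ( √2 a b/√((a+1)(2a+3)) ) + ( 6a+1 + (28a²+12a+3)/(2a(2a+1))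 ) · ( b/(2√(2π)(2a+1)√(2a+3)) ) e^{-3a b²/(2a+3)} + [ b² + 3(1-a)/(2a) ] · (√π b/√(2a)) [ Φ_{Σ₁}(0,b) + Φ_{Σ₂}(0,b) ], where Σ₁ has entries Σ₁₁ = 3/2, Σ₁₂ = Σ₂₁ = -1/2, Σ₂₂ = (1+a)/(2a), and Σ₂ has entries Σ₁₁ = 3/2, Σ₁₂ = Σ₂₁ = -1, Σ₂₂ = (1+2a)/(2a). -/
open MeasureTheory Real Matrix

/-- Centered bivariate Gaussian cumulative distribution function with covariance `S`. -/
noncomputable def PhiMat (S : Matrix (Fin 2) (Fin 2) ℝ) (x₁ x₂ : ℝ) : ℝ :=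
  ∫ s in Set.Iic x₁, ∫ t in Set.Iic x₂,
    (2 * Real.pi * Real.sqrt S.det)⁻¹ *
      Real.exp (-(1 / 2) * (![s, t] ⬝ᵥ (S⁻¹ *ᵥ ![s, t])))

open Filter Asymptotics Set Topology

/-! ### Continuous functions of rapid decay and of at most exponential growth -/

/-- `f` is continuous and decays along `l` faster than every exponential. -/
def RapidDecay (l : Filter ℝ) (f : ℝ → ℝ) : Prop :=
  Continuous f ∧ ∀ k : ℕ, f =O[l] fun x => exp (-(k * |x|))

/-- `f` is continuous and grows at most exponentially. -/
@[fun_prop]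
def ExpGrowth (f : ℝ → ℝ) : Prop :=
  Continuous f ∧ ∃ k : ℕ, f =O[⊤] fun x => exp (k * |x|)

namespace ExpGrowth

variable {f g : ℝ → ℝ}

lemma of_bounded (hf : Continuous f) {C : ℝ} (hC : ∀ x, |f x| ≤ C) : ExpGrowth f :=
  ⟨hf, 0, IsBigO.of_bound C (.of_forall fun x => by simpa using hC x)⟩

@[fun_prop]
lemma const (c : ℝ) : ExpGrowth fun _ => c := of_bounded continuous_const fun _ => le_rfl

@[fun_prop]
lemma id : ExpGrowth fun x => x := by
  refine ⟨continuous_id, 1, IsBigO.of_bound 1 (.of_forall fun x => ?_)⟩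
  have := add_one_le_exp |x|
  simp only [norm_eq_abs, abs_exp, Nat.cast_one, one_mul]
  linarith

@[fun_prop]
lemma mul (hf : ExpGrowth f) (hg : ExpGrowth g) : ExpGrowth fun x => f x * g x := by
  obtain ⟨hf, m, hfm⟩ := hf
  obtain ⟨hg, n, hgn⟩ := hg
  refine ⟨hf.mul hg, m + n, (hfm.mul hgn).congr_right fun x => ?_⟩
  rw [← exp_add, Nat.cast_add, add_mul]

@[fun_prop]
lemma add (hf : ExpGrowth f) (hg : ExpGrowth g) : ExpGrowth fun x => f x + g x := by
  obtain ⟨hf, m, hfm⟩ := hf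
  obtain ⟨hg, n, hgn⟩ := hg
  refine ⟨hf.add hg, m + n, IsBigO.add (hfm.trans ?_) (hgn.trans ?_)⟩ <;>
  · refine IsBigO.of_bound 1 (.of_forall fun x => ?_)
    simp only [norm_eq_abs, abs_exp, one_mul]
    gcongr
    simp

@[fun_prop]
lemma neg (hf : ExpGrowth f) : ExpGrowth fun x => -f x := by
  simpa using (const (-1)).mul hf

@[fun_prop]
lemma sub (hf : ExpGrowth f) (hg : ExpGrowth g) : ExpGrowth fun x => f x - g x := by
  simpa only [sub_eq_add_neg] using hf.add hg.neg

@[fun_prop]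
lemma pow (hf : ExpGrowth f) (n : ℕ) : ExpGrowth fun x => f x ^ n := by
  induction n with
  | zero => simpa using const 1
  | succ n ih => simpa only [pow_succ] using ih.mul hf

@[fun_prop]
lemma div_const (hf : ExpGrowth f) (c : ℝ) : ExpGrowth fun x => f x / c := by
  simpa only [div_eq_mul_inv] using hf.mul (const c⁻¹)

end ExpGrowth

namespace RapidDecay

variable {l : Filter ℝ} {f g : ℝ → ℝ}

lemma mono {l' : Filter ℝ} (hf : RapidDecay l f) (h : l' ≤ l) : RapidDecay l' f :=
  ⟨hf.1, fun k => (hf.2 k).mono h⟩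

lemma add (hf : RapidDecay l f) (hg : RapidDecay l g) : RapidDecay l fun x => f x + g x :=
  ⟨hf.1.add hg.1, fun k => (hf.2 k).add (hg.2 k)⟩

lemma mul_expGrowth (hf : RapidDecay l f) (hg : ExpGrowth g) :
    RapidDecay l fun x => f x * g x := by
  obtain ⟨hg, m, hgm⟩ := hg
  refine ⟨hf.1.mul hg, fun k => ((hf.2 (k + m)).mul (hgm.mono le_top)).congr_right fun x => ?_⟩
  rw [← exp_add]
  push_cast
  ring_nf

lemma expGrowth (hf : RapidDecay ⊤ f) : ExpGrowth f := ⟨hf.1, 0, by simpa using hf.2 0⟩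

lemma tendsto_atBot (hf : RapidDecay atBot f) : Tendsto f atBot (𝓝 0) := by
  refine (hf.2 1).trans_tendsto ?_
  simpa [Function.comp_def] using tendsto_exp_atBot.comp
    (tendsto_neg_atTop_atBot.comp tendsto_abs_atBot_atTop)

lemma isBigO_inv_one_add_sq (hf : RapidDecay l f) : f =O[l] fun x => (1 + x ^ 2)⁻¹ := by
  refine (hf.2 2).trans (IsBigO.of_bound 1 (.of_forall fun x => ?_))
  have h1 : 1 + x ^ 2 ≤ exp (2 * |x|) := by
    rw [two_mul, exp_add, ← sq_abs]
    nlinarith [add_one_le_exp |x|, abs_nonneg x]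
  rw [norm_of_nonneg (exp_pos _).le, norm_of_nonneg (by positivity), one_mul, exp_neg]
  gcongr
  exact_mod_cast h1

lemma integrable (hf : RapidDecay ⊤ f) : Integrable f :=
  hf.1.locallyIntegrable.integrable_of_isBigO_cocompact
    (hf.isBigO_inv_one_add_sq.mono le_top) (integrable_inv_one_add_sq.integrableAtFilter _)

lemma integrableOn_Iic (hf : RapidDecay atBot f) (u : ℝ) : IntegrableOn f (Iic u) :=
  (hf.1.locallyIntegrable.locallyIntegrableOn _).integrableOn_of_isBigO_atBot
    hf.isBigO_inv_one_add_sq (integrable_inv_one_add_sq.integrableAtFilter _)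

lemma setIntegral_Iic_of_hasDerivAt {f' : ℝ → ℝ} (hf : RapidDecay atBot f)
    (hf' : RapidDecay atBot f') (h : ∀ x, HasDerivAt f (f' x) x) (u : ℝ) :
    ∫ x in Iic u, f' x = f u := by
  simpa using integral_Iic_of_hasDerivAt_of_tendsto' (fun x _ => h x)
    (hf'.integrableOn_Iic u) hf.tendsto_atBot

lemma integral_of_hasDerivAt {f' : ℝ → ℝ} (hf : RapidDecay ⊤ f)
    (hf' : RapidDecay ⊤ f') (h : ∀ x, HasDerivAt f (f' x) x) : ∫ x, f' x = 0 :=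
  integral_eq_zero_of_hasDerivAt_of_integrable h hf'.integrable hf.integrable

lemma exp_neg_mul_sub_sq {c : ℝ} (hc : 0 < c) (d : ℝ) :
    RapidDecay ⊤ fun x => exp (-c * (x - d) ^ 2) := by
  refine ⟨by fun_prop, fun k => IsBigO.of_bound (exp (k ^ 2 / (4 * c) + k * |d|))
    (.of_forall fun x => ?_)⟩
  rw [norm_of_nonneg (exp_pos _).le, norm_of_nonneg (exp_pos _).le, ← exp_add]
  gcongr
  have h1 : |x| ≤ |x - d| + |d| := by simpa using abs_add_le (x - d) d
  have h2 : k * |x - d| ≤ c * (x - d) ^ 2 + k ^ 2 / (4 * c) := by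
    rw [← sq_abs (x - d), ← sub_nonneg]
    have : c * |x - d| ^ 2 + k ^ 2 / (4 * c) - k * |x - d| =
        (2 * c * |x - d| - k) ^ 2 / (4 * c) := by field_simp; ring
    rw [this]
    positivity
  nlinarith [mul_le_mul_of_nonneg_left h1 (Nat.cast_nonneg (α := ℝ) k)]

end RapidDecay

/-! ### Primitives vanishing at `-∞` -/

/-- The primitive of `f` that vanishes at `-∞`. -/
noncomputable def primIic (f : ℝ → ℝ) (x : ℝ) : ℝ := ∫ t in Iic x, f t

namespace RapidDecay

variable {f : ℝ → ℝ}

lemma hasDerivAt_primIic (hf : RapidDecay ⊤ f) (x : ℝ) : HasDerivAt (primIic f) (f x) x := by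
  have h : primIic f = fun x => primIic f 0 + ∫ t in (0 : ℝ)..x, f t := by
    ext y
    rw [primIic, primIic, ← intervalIntegral.integral_Iic_sub_Iic hf.integrable.integrableOn
      hf.integrable.integrableOn]
    ring
  rw [h]
  exact (intervalIntegral.integral_hasDerivAt_right (hf.1.intervalIntegrable _ _)
    (hf.1.stronglyMeasurableAtFilter _ _) hf.1.continuousAt).const_add _

lemma continuous_primIic (hf : RapidDecay ⊤ f) : Continuous (primIic f) :=
  continuous_iff_continuousAt.2 fun x => (hf.hasDerivAt_primIic x).continuousAt

lemma expGrowth_primIic (hf : RapidDecay ⊤ f) : ExpGrowth (primIic f) := by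
  refine .of_bounded hf.continuous_primIic (C := ∫ t, ‖f t‖) fun x => ?_
  exact (norm_integral_le_integral_norm _).trans
    (setIntegral_le_integral hf.integrable.norm (.of_forall fun _ => norm_nonneg _))

lemma primIic_atBot (hf : RapidDecay ⊤ f) : RapidDecay atBot (primIic f) := by
  refine ⟨hf.continuous_primIic, fun k => ?_⟩
  obtain ⟨C, hC, h⟩ := (hf.2 (k + 1)).exists_pos
  refine IsBigO.of_bound C ((eventually_le_atBot 0).mono fun x hx => ?_)
  have hk : (0 : ℝ) < k + 1 := by positivity
  have hle : ‖primIic f x‖ ≤ ∫ t in Iic x, C * exp ((k + 1) * t) := by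
    refine norm_integral_le_of_norm_le ((integrableOn_exp_mul_Iic hk x).const_mul C)
      ((ae_restrict_mem measurableSet_Iic).mono fun t ht => ?_)
    have h1 : ‖f t‖ ≤ _ := isBigOWith_top.1 h t
    rw [abs_of_nonpos ((mem_Iic.1 ht).trans hx), norm_of_nonneg (exp_pos _).le] at h1
    simpa using h1
  refine hle.trans ?_
  rw [integral_const_mul, integral_exp_mul_Iic hk, norm_of_nonneg (exp_pos _).le,
    abs_of_nonpos hx]
  gcongr
  refine (div_le_self (exp_pos _).le (by linarith)).trans ?_
  gcongr
  nlinarith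

end RapidDecay

/-! ### Integration over the three smallest eigenvalues -/

/-- The unnormalised standard Gaussian density. -/
noncomputable def gauss (x : ℝ) : ℝ := exp (-(x ^ 2) / 2)

lemma rapidDecay_exp_neg_mul_sq {c : ℝ} (hc : 0 < c) : RapidDecay ⊤ fun x => exp (-c * x ^ 2) := by
  simpa using RapidDecay.exp_neg_mul_sub_sq hc 0

lemma gauss_eq : gauss = fun x => exp (-(1 / 2) * x ^ 2) := by
  ext x
  rw [gauss]
  ring_nf

lemma gauss_sq_eq : (fun x => gauss x ^ 2) = fun x => exp (-1 * x ^ 2) := by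
  ext x
  rw [gauss, ← exp_nat_mul]
  ring_nf

lemma rapidDecay_gauss : RapidDecay ⊤ gauss := by
  rw [gauss_eq]
  exact rapidDecay_exp_neg_mul_sq (by norm_num)

lemma rapidDecay_gauss_sq : RapidDecay ⊤ fun x => gauss x ^ 2 := by
  rw [gauss_sq_eq]
  exact rapidDecay_exp_neg_mul_sq one_pos

@[fun_prop]
lemma expGrowth_gauss : ExpGrowth fun x => gauss x := rapidDecay_gauss.expGrowth

/-- The primitive of `gauss` that vanishes at `-∞`. -/
noncomputable def gaussInt : ℝ → ℝ := primIic gauss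

/-- The primitive of `gauss ^ 2` that vanishes at `-∞`. -/
noncomputable def gaussSqInt : ℝ → ℝ := primIic fun x => gauss x ^ 2

@[fun_prop]
lemma expGrowth_gaussInt : ExpGrowth fun x => gaussInt x := rapidDecay_gauss.expGrowth_primIic

@[fun_prop]
lemma expGrowth_gaussSqInt : ExpGrowth fun x => gaussSqInt x :=
  rapidDecay_gauss_sq.expGrowth_primIic

lemma hasDerivAt_gauss (x : ℝ) : HasDerivAt gauss (-x * gauss x) x := by
  have h : HasDerivAt (fun y : ℝ => -(y ^ 2) / 2) (-x) x :=
    ((hasDerivAt_pow 2 x).neg.div_const 2).congr_deriv (by norm_num; ring)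
  exact h.exp.congr_deriv (by rw [gauss]; ring)

lemma hasDerivAt_gaussInt (x : ℝ) : HasDerivAt gaussInt (gauss x) x :=
  rapidDecay_gauss.hasDerivAt_primIic x

lemma hasDerivAt_gaussSqInt (x : ℝ) : HasDerivAt gaussSqInt (gauss x ^ 2) x :=
  rapidDecay_gauss_sq.hasDerivAt_primIic x

lemma hasDerivAt_quadratic (c₀ c₁ c₂ x : ℝ) :
    HasDerivAt (fun t => c₀ + c₁ * t + c₂ * t ^ 2) (c₁ + 2 * c₂ * x) x :=
  ((((hasDerivAt_id x).const_mul c₁).const_add c₀).add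
    ((hasDerivAt_pow 2 x).const_mul c₂)).congr_deriv (by norm_num; ring)

lemma rapidDecay_gauss_atBot : RapidDecay atBot gauss := rapidDecay_gauss.mono le_top

lemma rapidDecay_gaussInt : RapidDecay atBot gaussInt := rapidDecay_gauss.primIic_atBot

lemma rapidDecay_gaussSqInt : RapidDecay atBot gaussSqInt := rapidDecay_gauss_sq.primIic_atBot

lemma setIntegral_smallest (y z w : ℝ) :
    ∫ t in Iic y, gauss t * ((y - t) * (z - t) * (w - t)) =
      gaussInt y * (y * z * w + y + z + w) + gauss y * (z * w + 2) := by
  have key := RapidDecay.setIntegral_Iic_of_hasDerivAt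
    (f := fun t => gaussInt t * (y * z * w + y + z + w) + gauss t *
      (y * z + y * w + z * w + 2 + -(y + z + w) * t + 1 * t ^ 2))
    (f' := fun t => gauss t * ((y - t) * (z - t) * (w - t)))
    ((rapidDecay_gaussInt.mul_expGrowth (by fun_prop)).add
      (rapidDecay_gauss_atBot.mul_expGrowth (by fun_prop)))
    (rapidDecay_gauss_atBot.mul_expGrowth (by fun_prop))
    (fun t => (((hasDerivAt_gaussInt t).mul_const _).add
      ((hasDerivAt_gauss t).mul (hasDerivAt_quadratic _ _ _ t))).congr_deriv (by ring)) y
  rw [key]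
  ring

lemma setIntegral_two_smallest (z w : ℝ) :
    ∫ y in Iic z, gauss y * (((z - y) * (w - y)) *
        (gaussInt y * (y * z * w + y + z + w) + gauss y * (z * w + 2))) =
      gauss z * gaussInt z * (w ^ 2 - z * w - 2) + gauss z ^ 2 * (z * w ^ 2 + w - z / 2) +
        gaussSqInt z * (2 * z ^ 2 * w ^ 2 + 4 * z * w + 7 / 2 - z ^ 2 - w ^ 2) := by
  have key := RapidDecay.setIntegral_Iic_of_hasDerivAt
    (f := fun y => gauss y * (gaussInt y *
        ((z + w) ^ 2 - (z * w) ^ 2 - 3 * (z * w) - 2 + (z + w) * (z * w) * y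
          + -(z * w + 1) * y ^ 2) +
        gauss y * ((z + w) * (z * w + 1) + -(2 * (z * w) + 3) / 2 * y + 0 * y ^ 2)) +
        gaussSqInt y * (2 * (z * w) ^ 2 + 6 * (z * w) + 7 / 2 - (z + w) ^ 2))
    (f' := fun y => gauss y * (((z - y) * (w - y)) *
        (gaussInt y * (y * z * w + y + z + w) + gauss y * (z * w + 2))))
    ((rapidDecay_gauss_atBot.mul_expGrowth (by fun_prop)).add
      (rapidDecay_gaussSqInt.mul_expGrowth (by fun_prop)))
    (rapidDecay_gauss_atBot.mul_expGrowth (by fun_prop))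
    (fun y => (((hasDerivAt_gauss y).mul
      (((hasDerivAt_gaussInt y).mul (hasDerivAt_quadratic _ _ _ y)).add
        ((hasDerivAt_gauss y).mul (hasDerivAt_quadratic _ _ _ y)))).add
        ((hasDerivAt_gaussSqInt y).mul_const _)).congr_deriv (by
          simp only [Pi.mul_apply, Pi.add_apply]; ring)) z
  rw [key]
  ring

lemma setIntegral_three_smallest (w : ℝ) :
    ∫ z in Iic w, gauss z * ((w - z) *
        (gauss z * gaussInt z * (w ^ 2 - z * w - 2) + gauss z ^ 2 * (z * w ^ 2 + w - z / 2) +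
        gaussSqInt z * (2 * z ^ 2 * w ^ 2 + 4 * z * w + 7 / 2 - z ^ 2 - w ^ 2))) =
      3 / 2 * (w * gauss w ^ 3) + 1 / 2 * (w ^ 2 * (gauss w ^ 2 * gaussInt w))
        - gauss w ^ 2 * gaussInt w + 3 * (w ^ 2 * (gauss w * gaussSqInt w))
        + 3 / 2 * (gauss w * gaussSqInt w) + w ^ 3 * (gaussInt w * gaussSqInt w)
        - 3 / 2 * (w * (gaussInt w * gaussSqInt w)) := by
  have key := RapidDecay.setIntegral_Iic_of_hasDerivAt
    (f := fun z => gauss z * (gauss z * (gauss z *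
          (-(w ^ 3 - 2 * w) + (w ^ 2 - 1 / 2) * z + 0 * z ^ 2)
          + gaussInt z * (w ^ 2 - 1 + -w / 2 * z + 0 * z ^ 2))
        + gaussSqInt z *
          (3 / 2 - w ^ 2 + -(2 * w ^ 3 - 5 * w) * z + (2 * w ^ 2 - 1) * z ^ 2)) +
        gaussInt z * (gaussSqInt z * (w ^ 3 - 3 / 2 * w)))
    (f' := fun z => gauss z * ((w - z) *
        (gauss z * gaussInt z * (w ^ 2 - z * w - 2) + gauss z ^ 2 * (z * w ^ 2 + w - z / 2) +
        gaussSqInt z * (2 * z ^ 2 * w ^ 2 + 4 * z * w + 7 / 2 - z ^ 2 - w ^ 2))))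
    ((rapidDecay_gauss_atBot.mul_expGrowth (by fun_prop)).add
      (rapidDecay_gaussInt.mul_expGrowth (by fun_prop)))
    (rapidDecay_gauss_atBot.mul_expGrowth (by fun_prop))
    (fun z => (((hasDerivAt_gauss z).mul
      (((hasDerivAt_gauss z).mul (((hasDerivAt_gauss z).mul (hasDerivAt_quadratic _ _ _ z)).add
        ((hasDerivAt_gaussInt z).mul (hasDerivAt_quadratic _ _ _ z)))).add
        ((hasDerivAt_gaussSqInt z).mul (hasDerivAt_quadratic _ _ _ z)))).add
        ((hasDerivAt_gaussInt z).mul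
          ((hasDerivAt_gaussSqInt z).mul_const _))).congr_deriv (by
            simp only [Pi.mul_apply, Pi.add_apply]; ring)) w
  rw [key]
  ring

/-- The integral of the ordered density over the three smallest eigenvalues. -/
noncomputable def topMarginal (w : ℝ) : ℝ :=
  3 / 2 * (w * gauss w ^ 3) + 1 / 2 * (w ^ 2 * (gauss w ^ 2 * gaussInt w))
    - gauss w ^ 2 * gaussInt w + 3 * (w ^ 2 * (gauss w * gaussSqInt w))
    + 3 / 2 * (gauss w * gaussSqInt w) + w ^ 3 * (gaussInt w * gaussSqInt w)
    - 3 / 2 * (w * (gaussInt w * gaussSqInt w))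

lemma setIntegral_eq_topMarginal (a b l4 : ℝ) :
    ∫ l3 in Iic l4, ∫ l2 in Iic l3, ∫ l1 in Iic l2,
        exp (-(l1 ^ 2) / 2) * exp (-(l2 ^ 2) / 2) * exp (-(l3 ^ 2) / 2) *
          exp (-a * (l4 - b) ^ 2) *
          ((l2 - l1) * (l3 - l1) * (l4 - l1) * (l3 - l2) * (l4 - l2) * (l4 - l3)) =
      exp (-a * (l4 - b) ^ 2) * topMarginal l4 := by
  rw [topMarginal, ← setIntegral_three_smallest, ← integral_const_mul]
  congr! 2 with l3
  rw [← setIntegral_two_smallest, ← integral_const_mul, ← integral_const_mul,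
    ← integral_const_mul]
  congr! 2 with l2
  rw [← setIntegral_smallest, ← integral_const_mul, ← integral_const_mul, ← integral_const_mul,
    ← integral_const_mul, ← integral_const_mul]
  congr! 2 with l1
  simp only [gauss]
  ring

/-! ### Weighted moments -/

/-- The integral of `f` against the weight `exp (-a * (x - b) ^ 2)`. -/
noncomputable def weighted (a b : ℝ) (f : ℝ → ℝ) : ℝ := ∫ x, exp (-a * (x - b) ^ 2) * f x

section weighted

variable {a b : ℝ} {f g f' : ℝ → ℝ}

lemma integrable_weight_mul (ha : 0 < a) (hf : ExpGrowth f) :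
    Integrable fun x => exp (-a * (x - b) ^ 2) * f x :=
  ((RapidDecay.exp_neg_mul_sub_sq ha b).mul_expGrowth hf).integrable

lemma weighted_add (ha : 0 < a) (hf : ExpGrowth f) (hg : ExpGrowth g) :
    weighted a b (fun x => f x + g x) = weighted a b f + weighted a b g := by
  simp only [weighted, mul_add]
  exact integral_add (integrable_weight_mul ha hf) (integrable_weight_mul ha hg)

lemma weighted_const_mul (c : ℝ) : weighted a b (fun x => c * f x) = c * weighted a b f := by
  simp only [weighted, ← integral_const_mul]
  congr! 2 with x
  ring

lemma weighted_sub (ha : 0 < a) (hf : ExpGrowth f) (hg : ExpGrowth g) :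
    weighted a b (fun x => f x - g x) = weighted a b f - weighted a b g := by
  simp only [weighted, mul_sub]
  exact integral_sub (integrable_weight_mul ha hf) (integrable_weight_mul ha hg)

/-- Integration by parts against the weight. -/
lemma weighted_deriv (ha : 0 < a) (hf : ExpGrowth f) (hf' : ExpGrowth f')
    (h : ∀ x, HasDerivAt f (f' x) x) :
    weighted a b f' = 2 * a * (weighted a b (fun x => x * f x) - b * weighted a b f) := by
  have hW := RapidDecay.exp_neg_mul_sub_sq ha b
  have key := RapidDecay.integral_of_hasDerivAt
    (f' := fun x => exp (-a * (x - b) ^ 2) * (f' x - 2 * a * (x * f x - b * f x)))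
    (hW.mul_expGrowth hf)
    (hW.mul_expGrowth (by fun_prop)) fun x => by
      have h1 : HasDerivAt (fun y : ℝ => -a * (y - b) ^ 2) (-2 * a * (x - b)) x :=
        ((((hasDerivAt_id x).sub_const b).pow 2).const_mul (-a)).congr_deriv
          (by simp only [id]; norm_num; ring)
      exact (h1.exp.mul (h x)).congr_deriv (by ring)
  change weighted a b (fun x => f' x - 2 * a * (x * f x - b * f x)) = 0 at key
  rw [weighted_sub ha hf' (by fun_prop), weighted_const_mul, weighted_sub ha (by fun_prop)
    (by fun_prop), weighted_const_mul] at key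
  linarith

lemma weighted_moment_succ (ha : 0 < a) (hf : ExpGrowth f) (hf' : ExpGrowth f')
    (h : ∀ x, HasDerivAt f (f' x) x) (n : ℕ) :
    2 * a * weighted a b (fun x => x ^ (n + 1) * f x) =
      2 * a * b * weighted a b (fun x => x ^ n * f x) +
        n * weighted a b (fun x => x ^ (n - 1) * f x) + weighted a b (fun x => x ^ n * f' x) := by
  have key := weighted_deriv (b := b) (f := fun x => x ^ n * f x)
    (f' := fun x => n * (x ^ (n - 1) * f x) + x ^ n * f' x) ha (by fun_prop) (by fun_prop)
    fun x => ((hasDerivAt_pow n x).mul (h x)).congr_deriv (by ring)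
  rw [weighted_add ha (by fun_prop) (by fun_prop), weighted_const_mul] at key
  have hx : (fun x => x ^ (n + 1) * f x) = fun x => x * (x ^ n * f x) := by
    ext x
    ring
  rw [hx]
  linarith

lemma weighted_moment_succ_of_deriv_eq {g c} (ha : 0 < a) (hf : ExpGrowth f) (hg : ExpGrowth g)
    (h : ∀ x, HasDerivAt f (g x - c * (x * f x)) x) (n : ℕ) :
    (2 * a + c) * weighted a b (fun x => x ^ (n + 1) * f x) =
      2 * a * b * weighted a b (fun x => x ^ n * f x) +
        n * weighted a b (fun x => x ^ (n - 1) * f x) + weighted a b (fun x => x ^ n * g x) := by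
  have key := weighted_moment_succ (b := b) ha hf (by fun_prop) h n
  have hx : (fun x => x ^ n * (g x - c * (x * f x))) =
      fun x => x ^ n * g x - c * (x ^ (n + 1) * f x) := by
    ext x
    ring
  rw [hx, weighted_sub ha (by fun_prop) (by fun_prop), weighted_const_mul] at key
  linarith

end weighted

section moments

variable {a : ℝ} (b : ℝ)

lemma weighted_gauss_cube_succ (ha : 0 < a) (n : ℕ) :
    (2 * a + 3) * weighted a b (fun x => x ^ (n + 1) * gauss x ^ 3) =
      2 * a * b * weighted a b (fun x => x ^ n * gauss x ^ 3) +
        n * weighted a b (fun x => x ^ (n - 1) * gauss x ^ 3) := by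
  have key := weighted_moment_succ_of_deriv_eq (b := b) (f := fun x => gauss x ^ 3)
    (g := fun _ => 0) (c := 3) ha (by fun_prop) (by fun_prop)
    (fun x => ((hasDerivAt_gauss x).pow 3).congr_deriv (by norm_num; ring)) n
  simpa [weighted] using key

lemma weighted_gauss_sq_mul_gaussInt_succ (ha : 0 < a) (n : ℕ) :
    (2 * a + 2) * weighted a b (fun x => x ^ (n + 1) * (gauss x ^ 2 * gaussInt x)) =
      2 * a * b * weighted a b (fun x => x ^ n * (gauss x ^ 2 * gaussInt x)) +
        n * weighted a b (fun x => x ^ (n - 1) * (gauss x ^ 2 * gaussInt x)) +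
        weighted a b (fun x => x ^ n * gauss x ^ 3) :=
  weighted_moment_succ_of_deriv_eq (f := fun x => gauss x ^ 2 * gaussInt x) ha (by fun_prop)
    (by fun_prop) (fun x => (((hasDerivAt_gauss x).pow 2).mul (hasDerivAt_gaussInt x)).congr_deriv
      (by simp only [Pi.pow_apply]; norm_num; ring)) n

lemma weighted_gauss_mul_gaussSqInt_succ (ha : 0 < a) (n : ℕ) :
    (2 * a + 1) * weighted a b (fun x => x ^ (n + 1) * (gauss x * gaussSqInt x)) =
      2 * a * b * weighted a b (fun x => x ^ n * (gauss x * gaussSqInt x)) +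
        n * weighted a b (fun x => x ^ (n - 1) * (gauss x * gaussSqInt x)) +
        weighted a b (fun x => x ^ n * gauss x ^ 3) :=
  weighted_moment_succ_of_deriv_eq (f := fun x => gauss x * gaussSqInt x) ha (by fun_prop)
    (by fun_prop) (fun x => ((hasDerivAt_gauss x).mul (hasDerivAt_gaussSqInt x)).congr_deriv (by ring)) n

lemma hasDerivAt_gaussInt_mul_gaussSqInt (x : ℝ) :
    HasDerivAt (fun x => gaussInt x * gaussSqInt x)
      (gauss x * gaussSqInt x + gauss x ^ 2 * gaussInt x) x :=
  ((hasDerivAt_gaussInt x).mul (hasDerivAt_gaussSqInt x)).congr_deriv (by ring)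

lemma weighted_gaussInt_mul_gaussSqInt_succ (ha : 0 < a) (n : ℕ) :
    2 * a * weighted a b (fun x => x ^ (n + 1) * (gaussInt x * gaussSqInt x)) =
      2 * a * b * weighted a b (fun x => x ^ n * (gaussInt x * gaussSqInt x)) +
        n * weighted a b (fun x => x ^ (n - 1) * (gaussInt x * gaussSqInt x)) +
        (weighted a b (fun x => x ^ n * (gauss x * gaussSqInt x)) +
          weighted a b (fun x => x ^ n * (gauss x ^ 2 * gaussInt x))) := by
  rw [weighted_moment_succ (b := b) ha (by fun_prop) (by fun_prop)
    hasDerivAt_gaussInt_mul_gaussSqInt n, ← weighted_add ha (by fun_prop) (by fun_prop)]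
  simp only [mul_add]

/-- The weighted integral of the marginal in terms of the four basic integrals. -/
lemma weighted_topMarginal (ha : 0 < a) :
    weighted a b topMarginal =
      ((24 * a ^ 3 + 12 * a ^ 2 + 6 * a + 1) / (2 * a * (2 * a + 1) ^ 2) * b ^ 2 +
          (6 * a ^ 2 + 3 * a + 2) / (4 * a ^ 2 * (2 * a + 1)) + 3 / 2) *
          weighted a b (fun x => gauss x * gaussSqInt x) +
        ((a + 1) / (2 * a) * b ^ 2 + (1 - a) / (2 * a ^ 2) - 1) *
          weighted a b (fun x => gauss x ^ 2 * gaussInt x) +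
        (6 * a + 1 + (28 * a ^ 2 + 12 * a + 3) / (2 * a * (2 * a + 1))) *
          (b / (2 * (2 * a + 1))) * weighted a b (fun x => gauss x ^ 3) +
        (b ^ 2 + 3 * (1 - a) / (2 * a)) * b *
          weighted a b (fun x => gaussInt x * gaussSqInt x) := by
  have h : weighted a b topMarginal =
      3 / 2 * weighted a b (fun w => w ^ 1 * gauss w ^ 3)
      + 1 / 2 * weighted a b (fun w => w ^ 2 * (gauss w ^ 2 * gaussInt w))
      - weighted a b (fun w => gauss w ^ 2 * gaussInt w)
      + 3 * weighted a b (fun w => w ^ 2 * (gauss w * gaussSqInt w))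
      + 3 / 2 * weighted a b (fun w => gauss w * gaussSqInt w)
      + weighted a b (fun w => w ^ 3 * (gaussInt w * gaussSqInt w))
      - 3 / 2 * weighted a b (fun w => w ^ 1 * (gaussInt w * gaussSqInt w)) := by
    simp only [← weighted_const_mul]
    rw [← weighted_add ha, ← weighted_sub ha, ← weighted_add ha, ← weighted_add ha,
      ← weighted_add ha, ← weighted_sub ha]
    · congr 1
      ext w
      rw [topMarginal, pow_one]
    all_goals fun_prop
  have n1 := weighted_gauss_cube_succ b ha 0
  have m1 := weighted_gauss_sq_mul_gaussInt_succ b ha 0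
  have m2 := weighted_gauss_sq_mul_gaussInt_succ b ha 1
  have l1 := weighted_gauss_mul_gaussSqInt_succ b ha 0
  have l2 := weighted_gauss_mul_gaussSqInt_succ b ha 1
  have k1 := weighted_gaussInt_mul_gaussSqInt_succ b ha 0
  have k2 := weighted_gaussInt_mul_gaussSqInt_succ b ha 1
  have k3 := weighted_gaussInt_mul_gaussSqInt_succ b ha 2
  norm_num only [pow_zero, one_mul, zero_mul, add_zero, Nat.cast_zero, Nat.cast_one, zero_add,
    Nat.cast_ofNat] at n1 m1 m2 l1 l2 k1 k2 k3
  rw [h]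
  generalize weighted a b (fun x => gauss x ^ 3) = N₀ at *
  generalize weighted a b (fun x => x ^ 1 * gauss x ^ 3) = N₁ at *
  generalize weighted a b (fun x => gauss x ^ 2 * gaussInt x) = M₀ at *
  generalize weighted a b (fun x => x ^ 1 * (gauss x ^ 2 * gaussInt x)) = M₁ at *
  generalize weighted a b (fun x => x ^ 2 * (gauss x ^ 2 * gaussInt x)) = M₂ at *
  generalize weighted a b (fun x => gauss x * gaussSqInt x) = L₀ at *
  generalize weighted a b (fun x => x ^ 1 * (gauss x * gaussSqInt x)) = L₁ at *
  generalize weighted a b (fun x => x ^ 2 * (gauss x * gaussSqInt x)) = L₂ at *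
  generalize weighted a b (fun x => gaussInt x * gaussSqInt x) = K₀ at *
  generalize weighted a b (fun x => x ^ 1 * (gaussInt x * gaussSqInt x)) = K₁ at *
  generalize weighted a b (fun x => x ^ 2 * (gaussInt x * gaussSqInt x)) = K₂ at *
  generalize weighted a b (fun x => x ^ 3 * (gaussInt x * gaussSqInt x)) = K₃ at *
  have h1 : 2 * a + 1 ≠ 0 := by positivity
  have h2 : 2 * a + 2 ≠ 0 := by positivity
  have h3 : 2 * a + 3 ≠ 0 := by positivity
  have h0 : 2 * a ≠ 0 := by positivity
  rw [mul_comm, ← eq_div_iff (by assumption)] at n1 m1 m2 l1 l2 k1 k2 k3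
  subst k3 k2 k1 m2 m1 l2 l1 n1
  field_simp
  ring

end moments

/-! ### Gaussian integrals -/

lemma integral_exp_of_eq_neg_sq {q : ℝ → ℝ} {A m r : ℝ}
    (h : ∀ x, q x = -A * (x - m) ^ 2 + r) : ∫ x, exp (q x) = sqrt (π / A) * exp r := by
  simp only [h, exp_add]
  rw [integral_mul_const, integral_sub_right_eq_self fun x => exp (-A * x ^ 2),
    integral_gaussian]

/-- Integrability after a shear of the second variable. -/
lemma integrable_mul_comp_shear {f g h : ℝ → ℝ} (hf : Integrable f) (hg : Integrable g)
    (hh : Measurable h) :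
    Integrable (fun p : ℝ × ℝ => f p.1 * g (p.2 + h p.1)) (volume.prod volume) := by
  have hmp : MeasurePreserving (fun p : ℝ × ℝ => (p.1, p.2 + h p.1)) (volume.prod volume)
      (volume.prod volume) :=
    (MeasurePreserving.id volume).skew_product (g := fun x y => y + h x)
      (measurable_snd.add (hh.comp measurable_fst))
      (.of_forall fun x => map_add_right_eq_self volume (h x))
  exact hmp.integrable_comp_of_integrable (hf.mul_prod hg)

lemma primIic_eq_setIntegral_shift (g : ℝ → ℝ) (c x : ℝ) :
    primIic g x = ∫ u in Iic c, g (u + (x - c)) := by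
  have := (measurePreserving_add_right volume (x - c)).setIntegral_preimage_emb
    (measurableEmbedding_addRight (x - c)) g (Iic x)
  rw [primIic, ← this]
  simp

/-- The integral of `f * primIic g` as an integral over the gap between the two variables. -/
lemma integral_mul_primIic {f g : ℝ → ℝ} (hf : RapidDecay ⊤ f) (hg : RapidDecay ⊤ g) (c : ℝ) :
    ∫ x, f x * primIic g x = ∫ u in Iic c, ∫ x, f x * g (u + (x - c)) := by
  simp only [primIic_eq_setIntegral_shift g c, ← integral_const_mul]
  refine integral_integral_swap ?_
  have h := integrable_mul_comp_shear hf.integrable hg.integrable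
    (h := fun x => x - c) (by fun_prop)
  exact h.mono_measure (Measure.prod_mono le_rfl Measure.restrict_le_self)

lemma primIic_exp_neg_mul_sq {δ : ℝ} (hδ : 0 < δ) (x : ℝ) :
    primIic (fun t => exp (-δ * t ^ 2)) x = sqrt (π / δ) * Phi (sqrt (2 * δ) * x) := by
  have hs : 0 < sqrt (2 * δ) := by positivity
  have hg : (fun t => exp (-δ * t ^ 2)) = fun t => gauss (sqrt (2 * δ) • t) := by
    ext t
    rw [gauss, smul_eq_mul, mul_pow, sq_sqrt (by positivity)]
    ring_nf
  rw [hg, primIic, Measure.setIntegral_comp_smul_of_pos _ _ _ hs, Module.finrank_self, pow_one,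
    LinearOrderedField.smul_Iic hs, smul_eq_mul, Phi, integral_const_mul, ← mul_assoc]
  congr 1
  rw [sqrt_div pi_pos.le, sqrt_mul zero_le_two, sqrt_mul zero_le_two]
  field_simp

lemma integral_exp_mul_primIic_exp {α γ : ℝ} (hα : 0 < α) (hγ : 0 < γ) (c : ℝ) :
    ∫ x, exp (-α * (x - c) ^ 2) * primIic (fun t => exp (-γ * t ^ 2)) x =
      π / sqrt (α * γ) * Phi (sqrt (2 * (α * γ / (α + γ))) * c) := by
  rw [integral_mul_primIic (RapidDecay.exp_neg_mul_sub_sq hα c) (rapidDecay_exp_neg_mul_sq hγ) 0]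
  have h : ∀ u, ∫ x, exp (-α * (x - c) ^ 2) * exp (-γ * (u + (x - 0)) ^ 2) =
      sqrt (π / (α + γ)) * exp (-(α * γ / (α + γ)) * (u + (c - 0)) ^ 2) := fun u => by
    simp only [← exp_add]
    apply integral_exp_of_eq_neg_sq (m := (α * c - γ * u) / (α + γ))
    intro x
    field_simp
    ring
  simp only [h]
  rw [integral_const_mul, ← primIic_eq_setIntegral_shift (fun t => exp (-_ * t ^ 2)) 0 c,
    primIic_exp_neg_mul_sq (by positivity), ← mul_assoc, ← sqrt_mul (by positivity)]
  congr 1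
  rw [← sqrt_sq (by positivity : 0 ≤ π / sqrt (α * γ)), div_pow, sq_sqrt (by positivity)]
  congr 1
  field_simp

lemma phiMat_eq (p q r x y : ℝ) :
    PhiMat !![p, q; q, r] x y = ∫ s in Iic x, ∫ t in Iic y,
      (2 * π * sqrt (p * r - q * q))⁻¹ *
        exp (-(1 / 2) * ((r * s ^ 2 - 2 * q * s * t + p * t ^ 2) / (p * r - q * q))) := by
  rw [PhiMat]
  congr! 8 with s t
  · rw [Matrix.det_fin_two_of]
  · rw [Matrix.inv_def, Matrix.adjugate_fin_two_of, Matrix.det_fin_two_of, Ring.inverse_eq_inv']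
    simp [Matrix.mulVec, dotProduct, Fin.sum_univ_two]
    ring

lemma integrable_exp_neg_shear {A B : ℝ} (hA : 0 < A) (hB : 0 < B) (k : ℝ) :
    Integrable (fun p : ℝ × ℝ => exp (-B * p.1 ^ 2) * exp (-A * (p.2 + k * p.1) ^ 2))
      (volume.prod volume) :=
  integrable_mul_comp_shear (rapidDecay_exp_neg_mul_sq hB).integrable
    (rapidDecay_exp_neg_mul_sq hA).integrable (by fun_prop)

/-- A Gaussian probability of the event `Z ≤ Y ≤ X` as a bivariate distribution function. -/
lemma weighted_primIic_exp_mul_primIic {a γ₁ γ₂ : ℝ} (ha : 0 < a) (h₁ : 0 < γ₁) (h₂ : 0 < γ₂)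
    (b : ℝ) :
    weighted a b (primIic fun y => exp (-γ₁ * y ^ 2) * primIic (fun z => exp (-γ₂ * z ^ 2)) y) =
      π * sqrt π / sqrt (a * γ₁ * γ₂) *
        PhiMat !![1 / (2 * γ₁) + 1 / (2 * γ₂), -(1 / (2 * γ₁));
          -(1 / (2 * γ₁)), 1 / (2 * γ₁) + 1 / (2 * a)] 0 b := by
  have hg₁ := rapidDecay_exp_neg_mul_sq h₁
  have hg₂ := rapidDecay_exp_neg_mul_sq h₂
  rw [weighted, integral_mul_primIic (RapidDecay.exp_neg_mul_sub_sq ha b)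
    (hg₁.mul_expGrowth hg₂.expGrowth_primIic) b]
  have hA : 0 < a * (γ₁ + γ₂) / (a + γ₁ + γ₂) := by positivity
  have hB : 0 < γ₁ * γ₂ / (γ₁ + γ₂) := by positivity
  have hin : ∀ t, ∫ x, exp (-a * (x - b) ^ 2) * (exp (-γ₁ * (t + (x - b)) ^ 2) *
      primIic (fun z => exp (-γ₂ * z ^ 2)) (t + (x - b))) =
      ∫ s in Iic 0, sqrt (π / (a + γ₁ + γ₂)) * (exp (-(γ₁ * γ₂ / (γ₁ + γ₂)) * s ^ 2) *
        exp (-(a * (γ₁ + γ₂) / (a + γ₁ + γ₂)) * (t + γ₂ / (γ₁ + γ₂) * s) ^ 2)) := fun t => by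
    have hshift := integral_add_right_eq_self (μ := volume) (fun y => exp (-a * (y - t) ^ 2) *
      exp (-γ₁ * y ^ 2) * primIic (fun z => exp (-γ₂ * z ^ 2)) y) (t - b)
    have := integral_mul_primIic ((RapidDecay.exp_neg_mul_sub_sq ha t).mul_expGrowth
      hg₁.expGrowth) hg₂ 0
    rw [← hshift] at this
    refine Eq.trans ?_ (this.trans ?_)
    · congr! 2 with x
      rw [show x + (t - b) = t + (x - b) by ring, show t + (x - b) - t = x - b by ring, mul_assoc]
    · congr! 2 with s
      simp only [← exp_add]
      apply integral_exp_of_eq_neg_sq (m := (a * t - γ₂ * s) / (a + γ₁ + γ₂))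
      intro x
      field_simp
      ring
  have hdet : (1 / (2 * γ₁) + 1 / (2 * γ₂)) * (1 / (2 * γ₁) + 1 / (2 * a)) -
      -(1 / (2 * γ₁)) * -(1 / (2 * γ₁)) = (a + γ₁ + γ₂) / (2 ^ 2 * (a * γ₁ * γ₂)) := by
    field_simp
    ring
  simp only [hin]
  rw [integral_integral_swap, phiMat_eq, hdet, ← integral_const_mul]
  · congr! 2 with s
    rw [← integral_const_mul]
    congr! 2 with t
    rw [← exp_add, ← mul_assoc]
    congr 1
    · rw [← div_eq_mul_inv, sqrt_div (by positivity), sqrt_div (by positivity),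
        sqrt_mul (by positivity) (a * γ₁ * γ₂), sqrt_sq zero_le_two]
      field_simp
    · congr 1
      field_simp
      ring
  · have h := (integrable_exp_neg_shear hA hB (γ₂ / (γ₁ + γ₂))).swap.const_mul
      (sqrt (π / (a + γ₁ + γ₂)))
    rw [Measure.prod_restrict]
    exact h.integrableOn

/-! ### The four basic integrals -/

section basic

variable {a : ℝ} (b : ℝ)

lemma weighted_gauss_cube (ha : 0 < a) :
    weighted a b (fun x => gauss x ^ 3) =
      2 * π * (1 / (sqrt (2 * π) * sqrt (2 * a + 3)) * exp (-(3 * a * b ^ 2) / (2 * a + 3))) := by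
  have h : ∀ x, -a * (x - b) ^ 2 + 3 * (-(x ^ 2) / 2) =
      -((2 * a + 3) / 2) * (x - 2 * a * b / (2 * a + 3)) ^ 2 + -(3 * a * b ^ 2) / (2 * a + 3) :=
    fun x => by field_simp; ring
  have hq := integral_exp_of_eq_neg_sq h
  simp only [exp_add] at hq
  rw [weighted, ← mul_assoc]
  convert hq using 1
  · simp only [gauss, ← exp_nat_mul, Nat.cast_ofNat]
  · congr 1
    have hs := mul_self_sqrt (by positivity : 0 ≤ 2 * π)
    rw [div_div_eq_mul_div, sqrt_div (by positivity), mul_comm π 2]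
    field_simp
    linarith

lemma weighted_gauss_mul_gaussSqInt (ha : 0 < a) :
    weighted a b (fun x => gauss x * gaussSqInt x) =
      2 * π * (1 / sqrt (2 * (2 * a + 1)) * exp (-a * b ^ 2 / (2 * a + 1)) *
        Phi (2 * sqrt 2 * a * b / sqrt ((2 * a + 1) * (2 * a + 3)))) := by
  have h : ∀ x, exp (-a * (x - b) ^ 2) * (gauss x * gaussSqInt x) =
      exp (-a * b ^ 2 / (2 * a + 1)) * (exp (-((2 * a + 1) / 2) * (x - 2 * a * b / (2 * a + 1)) ^ 2)
        * primIic (fun t => exp (-1 * t ^ 2)) x) := fun x => by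
    rw [gaussSqInt, gauss_sq_eq, gauss, ← mul_assoc, ← mul_assoc, ← exp_add, ← exp_add]
    congr 2
    field_simp
    ring
  simp only [weighted, h]
  rw [integral_const_mul, integral_exp_mul_primIic_exp (by positivity) one_pos]
  have hΦ : sqrt (2 * ((2 * a + 1) / 2 * 1 / ((2 * a + 1) / 2 + 1))) * (2 * a * b / (2 * a + 1)) =
      2 * sqrt 2 * a * b / sqrt ((2 * a + 1) * (2 * a + 3)) := by
    rw [show 2 * ((2 * a + 1) / 2 * 1 / ((2 * a + 1) / 2 + 1)) =
      2 * (2 * a + 1) ^ 2 / ((2 * a + 1) * (2 * a + 3)) by field_simp; ring,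
      sqrt_div (by positivity), sqrt_mul zero_le_two, sqrt_sq (by positivity)]
    field_simp
  have hs : π / sqrt ((2 * a + 1) / 2 * 1) = 2 * π * (1 / sqrt (2 * (2 * a + 1))) := by
    rw [show (2 * a + 1) / 2 * 1 = 2 * (2 * a + 1) / 2 ^ 2 by ring, sqrt_div (by positivity),
      sqrt_sq zero_le_two]
    field_simp
  rw [hΦ, hs]
  ring

lemma weighted_gauss_sq_mul_gaussInt (ha : 0 < a) :
    weighted a b (fun x => gauss x ^ 2 * gaussInt x) =
      2 * π * (1 / sqrt (2 * (a + 1)) * exp (-a * b ^ 2 / (a + 1)) *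
        Phi (sqrt 2 * a * b / sqrt ((a + 1) * (2 * a + 3)))) := by
  have h : ∀ x, exp (-a * (x - b) ^ 2) * (gauss x ^ 2 * gaussInt x) =
      exp (-a * b ^ 2 / (a + 1)) * (exp (-(a + 1) * (x - a * b / (a + 1)) ^ 2)
        * primIic (fun t => exp (-(1 / 2) * t ^ 2)) x) := fun x => by
    rw [gaussInt, congrFun gauss_sq_eq x, gauss_eq, ← mul_assoc, ← mul_assoc, ← exp_add, ← exp_add]
    congr 2
    field_simp
    ring
  simp only [weighted, h]
  rw [integral_const_mul, integral_exp_mul_primIic_exp (by positivity) (by norm_num)]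
  have hΦ : sqrt (2 * ((a + 1) * (1 / 2) / (a + 1 + 1 / 2))) * (a * b / (a + 1)) =
      sqrt 2 * a * b / sqrt ((a + 1) * (2 * a + 3)) := by
    rw [show 2 * ((a + 1) * (1 / 2) / (a + 1 + 1 / 2)) =
      2 * (a + 1) ^ 2 / ((a + 1) * (2 * a + 3)) by field_simp; ring,
      sqrt_div (by positivity), sqrt_mul zero_le_two, sqrt_sq (by positivity)]
    field_simp
  have hs : π / sqrt ((a + 1) * (1 / 2)) = 2 * π * (1 / sqrt (2 * (a + 1))) := by
    rw [show (a + 1) * (1 / 2) = 2 * (a + 1) / 2 ^ 2 by ring, sqrt_div (by positivity),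
      sqrt_sq zero_le_two]
    field_simp
  rw [hΦ, hs]
  ring

lemma gaussInt_mul_gaussSqInt_eq (x : ℝ) :
    gaussInt x * gaussSqInt x =
      primIic (fun y => exp (-1 * y ^ 2) * primIic (fun z => exp (-(1 / 2) * z ^ 2)) y) x +
        primIic (fun y => exp (-(1 / 2) * y ^ 2) * primIic (fun z => exp (-1 * z ^ 2)) y) x := by
  have h1 := rapidDecay_gauss.mul_expGrowth expGrowth_gaussSqInt
  have h2 := rapidDecay_gauss_sq.mul_expGrowth expGrowth_gaussInt
  have key := RapidDecay.setIntegral_Iic_of_hasDerivAt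
    (rapidDecay_gaussInt.mul_expGrowth expGrowth_gaussSqInt) ((h1.add h2).mono le_top)
    hasDerivAt_gaussInt_mul_gaussSqInt x
  rw [← key, integral_add h1.integrable.integrableOn h2.integrable.integrableOn, add_comm]
  simp only [gaussInt, gaussSqInt, congrFun gauss_sq_eq]
  simp only [gauss_eq]
  rfl

lemma weighted_gaussInt_mul_gaussSqInt (ha : 0 < a) :
    weighted a b (fun x => gaussInt x * gaussSqInt x) =
      2 * π * (sqrt π / sqrt (2 * a) *
        (PhiMat !![3 / 2, -(1 / 2); -(1 / 2), (1 + a) / (2 * a)] 0 b +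
          PhiMat !![3 / 2, -1; -1, (1 + 2 * a) / (2 * a)] 0 b)) := by
  have hh : (0 : ℝ) < 1 / 2 := by norm_num
  have hg₁ := rapidDecay_exp_neg_mul_sq one_pos
  have hg₂ := rapidDecay_exp_neg_mul_sq hh
  simp only [gaussInt_mul_gaussSqInt_eq]
  rw [weighted_add ha (hg₁.mul_expGrowth hg₂.expGrowth_primIic).expGrowth_primIic
    (hg₂.mul_expGrowth hg₁.expGrowth_primIic).expGrowth_primIic,
    weighted_primIic_exp_mul_primIic ha one_pos hh, weighted_primIic_exp_mul_primIic ha hh one_pos]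
  have e1 : 1 / (2 * 1) + 1 / (2 * a) = (1 + a) / (2 * a) := by field_simp; ring
  have e2 : 1 / (2 * (1 / 2)) + 1 / (2 * a) = (1 + 2 * a) / (2 * a) := by field_simp; ring
  have hs : π * sqrt π / sqrt (a * (1 / 2)) = 2 * π * (sqrt π / sqrt (2 * a)) := by
    rw [show a * (1 / 2) = 2 * a / 2 ^ 2 by ring, sqrt_div (by positivity), sqrt_sq zero_le_two]
    field_simp
  have e3 : 1 / (2 * 1) + 1 / (2 * (1 / 2)) = (3 / 2 : ℝ) := by norm_num
  have e4 : 1 / (2 * (1 / 2)) + 1 / (2 * 1) = (3 / 2 : ℝ) := by norm_num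
  rw [e1, e2, e3, e4, mul_one a, mul_one (a * (1 / 2)), hs]
  norm_num only
  ring

end basic

theorem stmt5 (a b : ℝ) (ha : 0 < a) :
    (1 / (2 * Real.pi)) *
        ∫ l4 : ℝ, ∫ l3 in Set.Iic l4, ∫ l2 in Set.Iic l3, ∫ l1 in Set.Iic l2,
          Real.exp (-(l1 ^ 2) / 2) * Real.exp (-(l2 ^ 2) / 2) *
            Real.exp (-(l3 ^ 2) / 2) * Real.exp (-a * (l4 - b) ^ 2) *
            ((l2 - l1) * (l3 - l1) * (l4 - l1) * (l3 - l2) * (l4 - l2) * (l4 - l3)) =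
      ((24 * a ^ 3 + 12 * a ^ 2 + 6 * a + 1) / (2 * a * (2 * a + 1) ^ 2) * b ^ 2 +
            (6 * a ^ 2 + 3 * a + 2) / (4 * a ^ 2 * (2 * a + 1)) + 3 / 2) *
          (1 / Real.sqrt (2 * (2 * a + 1))) * Real.exp (-a * b ^ 2 / (2 * a + 1)) *
          Phi (2 * Real.sqrt 2 * a * b / Real.sqrt ((2 * a + 1) * (2 * a + 3))) +
        ((a + 1) / (2 * a) * b ^ 2 + (1 - a) / (2 * a ^ 2) - 1) *
          (1 / Real.sqrt (2 * (a + 1))) * Real.exp (-a * b ^ 2 / (a + 1)) *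
          Phi (Real.sqrt 2 * a * b / Real.sqrt ((a + 1) * (2 * a + 3))) +
        (6 * a + 1 + (28 * a ^ 2 + 12 * a + 3) / (2 * a * (2 * a + 1))) *
          (b / (2 * Real.sqrt (2 * Real.pi) * (2 * a + 1) * Real.sqrt (2 * a + 3))) *
          Real.exp (-(3 * a * b ^ 2) / (2 * a + 3)) +
        (b ^ 2 + 3 * (1 - a) / (2 * a)) * (Real.sqrt Real.pi * b / Real.sqrt (2 * a)) *
          (PhiMat !![3 / 2, -(1 / 2); -(1 / 2), (1 + a) / (2 * a)] 0 b +
            PhiMat !![3 / 2, -1; -1, (1 + 2 * a) / (2 * a)] 0 b) := by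
  simp only [setIntegral_eq_topMarginal]
  change 1 / (2 * π) * weighted a b topMarginal = _
  rw [weighted_topMarginal b ha, weighted_gauss_cube b ha, weighted_gauss_mul_gaussSqInt b ha,
    weighted_gauss_sq_mul_gaussInt b ha, weighted_gaussInt_mul_gaussSqInt b ha]
  have hd : b / (2 * sqrt (2 * π) * (2 * a + 1) * sqrt (2 * a + 3)) =
      b / (2 * (2 * a + 1)) * (1 / (sqrt (2 * π) * sqrt (2 * a + 3))) := by
    field_simp
  rw [one_div_mul_eq_div, div_eq_iff (by positivity), hd]
  ring
end
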